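/- There is a universal constant c > 0 (independent of K, T, the losses, and the predictions) such that under the base AdaProd⁺ recursion, for every expert i ∈ {1,…,K}: Σ_{t=1}^{T} r_{t,i} ≤ c · ( log K + log(log(T + 3)) + ( √(log K) + log(log(T + 3)) ) · √(C_{T,i}) ). -/

import Mathlib

open Finset

theorem Real.exp_sub_sq_le_one_add {x : ℝ} (hx : -(2 / 3) ≤ x) :
    Real.exp (x - x ^ 2) ≤ 1 + x := by
  let f : ℝ → ℝ := fun y => Real.log (1 + y) - (y - y ^ 2)
  have hderiv : ∀ y : ℝ, -1 < y → HasDerivAt f (y * (1 + 2 * y) / (1 + y)) y := by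
    intro y hy
    have hy' : 1 + y ≠ 0 := by linarith
    have h := (((hasDerivAt_id y).const_add 1).log hy').sub
      ((hasDerivAt_id y).sub ((hasDerivAt_id y).pow 2))
    refine h.congr_deriv ?_
    simp only [id, Nat.cast_ofNat]
    field_simp
    ring
  have hcont : ∀ s : Set ℝ, (∀ y ∈ s, -1 < y) → ContinuousOn f s := fun s hs y hy =>
    (hderiv y (hs y hy)).continuousAt.continuousWithinAt
  have hzero : f 0 = 0 := by simp [f]
  have hf : 0 ≤ f x := by
    rcases le_total x (-(1 / 2)) with h1 | h1
    · have hmono : MonotoneOn f (Set.Icc (-(2 / 3)) (-(1 / 2))) := by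
        refine monotoneOn_of_deriv_nonneg (convex_Icc _ _)
          (hcont _ fun y hy => by linarith [hy.1]) ?_ ?_ <;> rw [interior_Icc]
        · exact fun y hy =>
            (hderiv y (by linarith [hy.1])).differentiableAt.differentiableWithinAt
        · intro y hy
          rw [(hderiv y (by linarith [hy.1])).deriv]
          exact div_nonneg (by nlinarith [hy.1, hy.2]) (by linarith [hy.1])
      have h := hmono (Set.mem_Icc.2 ⟨le_rfl, by norm_num⟩) (Set.mem_Icc.2 ⟨hx, h1⟩) hx
      refine le_trans ?_ h
      have h3 : Real.log 3 ≤ 10 / 9 := by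
        rw [Real.log_le_iff_le_exp (by norm_num)]
        refine le_trans ?_ (Real.sum_le_exp_of_nonneg (by norm_num) 6)
        norm_num [Finset.sum_range_succ, Nat.factorial]
      have h4 : f (-(2 / 3)) = -Real.log 3 + 10 / 9 := by
        simp only [f]
        rw [show (1 + -(2 / 3) : ℝ) = 3⁻¹ by norm_num, Real.log_inv]
        norm_num
      linarith
    · rcases le_total x 0 with h2 | h2
      · have hanti : AntitoneOn f (Set.Icc (-(1 / 2)) 0) := by
          refine antitoneOn_of_deriv_nonpos (convex_Icc _ _)
            (hcont _ fun y hy => by linarith [hy.1]) ?_ ?_ <;> rw [interior_Icc]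
          · exact fun y hy =>
              (hderiv y (by linarith [hy.1])).differentiableAt.differentiableWithinAt
          · intro y hy
            rw [(hderiv y (by linarith [hy.1])).deriv]
            exact div_nonpos_of_nonpos_of_nonneg (by nlinarith [hy.1, hy.2]) (by linarith [hy.1])
        have h := hanti (Set.mem_Icc.2 ⟨h1, h2⟩) (Set.mem_Icc.2 ⟨by norm_num, le_rfl⟩) h2
        linarith
      · have hmono : MonotoneOn f (Set.Ici 0) := by
          refine monotoneOn_of_deriv_nonneg (convex_Ici _)
            (hcont _ fun y hy => by linarith [Set.mem_Ici.1 hy]) ?_ ?_ <;> rw [interior_Ici]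
          · exact fun y hy =>
              (hderiv y (by linarith [Set.mem_Ioi.1 hy])).differentiableAt.differentiableWithinAt
          · intro y hy
            have hy' : 0 < y := hy
            rw [(hderiv y (by linarith)).deriv]
            positivity
        have h := hmono (Set.mem_Ici.2 le_rfl) (Set.mem_Ici.2 h2) h2
        linarith
  rw [← Real.le_log_iff_exp_le (by linarith)]
  simp only [f] at hf
  linarith

theorem Real.exp_sub_sq_le_two (x : ℝ) : Real.exp (x - x ^ 2) ≤ 2 := by
  have h : x - x ^ 2 ≤ 1 / 4 := by nlinarith [sq_nonneg (x - 1 / 2)]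
  have h2 : (1 / 4 : ℝ) ≤ Real.log 2 := by linarith [Real.log_two_gt_d9]
  calc Real.exp (x - x ^ 2) ≤ Real.exp (Real.log 2) := Real.exp_le_exp.2 (h.trans h2)
    _ = 2 := Real.exp_log (by norm_num)

theorem Real.exp_mul_one_sub_le_one (x : ℝ) : Real.exp x * (1 - x) ≤ 1 := by
  have h := mul_le_mul_of_nonneg_left (Real.add_one_le_exp (-x)) (Real.exp_pos x).le
  rw [← Real.exp_add, add_neg_cancel, Real.exp_zero] at h
  linarith

theorem Real.rpow_le_add_inv_sub_one {x β : ℝ} (hx : 0 ≤ x) (hβ : 0 < β) (hβ1 : β ≤ 1) :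
    x ^ β ≤ x + (β⁻¹ - 1) := by
  have hy : 0 ≤ x ^ β := Real.rpow_nonneg hx β
  have hα : 1 ≤ β⁻¹ := (one_le_inv₀ hβ).2 hβ1
  have h := one_add_mul_self_le_rpow_one_add (s := x ^ β - 1) (by linarith) hα
  rw [add_sub_cancel, ← Real.rpow_mul hx, mul_inv_cancel₀ hβ.ne', Real.rpow_one] at h
  nlinarith

theorem adaptiveRate_pos {L : ℝ} {T t : ℕ} {m C η : ℕ → ℝ} (hL : 0 < L)
    (rate_zero : η 0 = Real.sqrt (L / 2))
    (rate_succ : ∀ t < T, η (t + 1) =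
      min (η t) (min (2 / (3 * (1 + m (t + 2)))) (Real.sqrt (L / C (t + 1)))))
    (error_pos : ∀ t < T, 0 < C (t + 1)) (pred_gt : ∀ t < T + 1, -1 < m (t + 1))
    (ht : t ≤ T) : 0 < η t := by
  induction t with
  | zero =>
    rw [rate_zero]
    exact Real.sqrt_pos.2 (by linarith)
  | succ t ih =>
    rw [rate_succ t ht]
    have hm := pred_gt (t + 1) (by omega)
    refine lt_min (ih (by omega)) (lt_min (div_pos two_pos (by linarith)) ?_)
    exact Real.sqrt_pos.2 (div_pos hL (error_pos t ht))

/-- The adaptive learning rates `η` of one expert with instantaneous regrets `r`, predictions `m`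
and cumulative squared prediction errors `C`, where `L` stands for the logarithm of the number of
experts. -/
structure IsAdaptiveRate (L : ℝ) (T : ℕ) (m r C η : ℕ → ℝ) : Prop where
  half_le : 1 / 2 ≤ L
  rate_zero : η 0 = Real.sqrt (L / 2)
  error_zero : C 0 = 0
  error_succ : ∀ t < T, C (t + 1) = C t + (m (t + 1) - r (t + 1)) ^ 2
  rate_succ : ∀ t < T, η (t + 1) =
    min (η t) (min (2 / (3 * (1 + m (t + 2)))) (Real.sqrt (L / C (t + 1))))
  error_pos : ∀ t < T, 0 < C (t + 1)
  pred_mem : ∀ t < T + 1, -1 < m (t + 1) ∧ m (t + 1) ≤ 1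
  regret_mem : ∀ t < T, -1 ≤ r (t + 1) ∧ r (t + 1) ≤ 1

namespace IsAdaptiveRate

variable {L : ℝ} {T t : ℕ} {m r C η : ℕ → ℝ}

theorem error_nonneg (h : IsAdaptiveRate L T m r C η) (ht : t ≤ T) : 0 ≤ C t := by
  cases t with
  | zero => exact h.error_zero.ge
  | succ t => exact (h.error_pos t ht).le

theorem error_le_succ (h : IsAdaptiveRate L T m r C η) (ht : t < T) : C t ≤ C (t + 1) := by
  rw [h.error_succ t ht]
  nlinarith [sq_nonneg (m (t + 1) - r (t + 1))]

theorem error_succ_le (h : IsAdaptiveRate L T m r C η) (ht : t < T) : C (t + 1) ≤ C t + 4 := by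
  rw [h.error_succ t ht]
  nlinarith [h.pred_mem t (by omega), h.regret_mem t ht]

theorem error_le (h : IsAdaptiveRate L T m r C η) (ht : t ≤ T) : C t ≤ 4 * t := by
  induction t with
  | zero => simp [h.error_zero]
  | succ t ih =>
    push_cast
    linarith [ih (by omega), h.error_succ_le (t := t) ht]

theorem rate_pos (h : IsAdaptiveRate L T m r C η) (ht : t ≤ T) : 0 < η t :=
  adaptiveRate_pos (by linarith [h.half_le]) h.rate_zero h.rate_succ h.error_pos
    (fun s hs => (h.pred_mem s hs).1) ht

theorem rate_succ_le (h : IsAdaptiveRate L T m r C η) (ht : t < T) : η (t + 1) ≤ η t := by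
  rw [h.rate_succ t ht]
  exact min_le_left _ _

theorem rate_le_sqrt (h : IsAdaptiveRate L T m r C η) (ht : t ≤ T) : η t ≤ Real.sqrt L := by
  induction t with
  | zero =>
    rw [h.rate_zero]
    exact Real.sqrt_le_sqrt (by linarith [h.half_le])
  | succ t ih => exact (h.rate_succ_le ht).trans (ih (by omega))

theorem rate_sq_mul_two_le (h : IsAdaptiveRate L T m r C η) (ht : t ≤ T) :
    η t ^ 2 * 2 ≤ L := by
  induction t with
  | zero =>
    rw [h.rate_zero, Real.sq_sqrt (by linarith [h.half_le])]
    linarith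
  | succ t ih =>
    have := pow_le_pow_left₀ (h.rate_pos ht).le (h.rate_succ_le ht) 2
    linarith [ih (by omega)]

theorem rate_sq_mul_error_le (h : IsAdaptiveRate L T m r C η) (ht : t ≤ T) :
    η t ^ 2 * C t ≤ L := by
  have hL := h.half_le
  cases t with
  | zero =>
    rw [h.error_zero]
    linarith
  | succ t =>
    have hC := h.error_pos t ht
    have hle : η (t + 1) ≤ Real.sqrt (L / C (t + 1)) := by
      rw [h.rate_succ t ht]
      exact (min_le_right _ _).trans (min_le_right _ _)
    have hsq := pow_le_pow_left₀ (h.rate_pos ht).le hle 2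
    rw [Real.sq_sqrt (by positivity), le_div_iff₀ hC] at hsq
    exact hsq

theorem rate_sq_mul_error_succ_le (h : IsAdaptiveRate L T m r C η) (ht : t < T) :
    η t ^ 2 * C (t + 1) ≤ 3 * L := by
  have h1 := h.rate_sq_mul_two_le ht.le
  have h2 := h.rate_sq_mul_error_le ht.le
  have h3 := mul_le_mul_of_nonneg_left (h.error_succ_le ht) (sq_nonneg (η t))
  linarith

theorem neg_two_thirds_le (h : IsAdaptiveRate L T m r C η) (ht : t + 1 < T) :
    -(2 / 3) ≤ η (t + 1) * (r (t + 2) - m (t + 2)) := by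
  have hm := (h.pred_mem (t + 1) (by omega)).1
  have hr := (h.regret_mem (t + 1) ht).1
  have hpos := h.rate_pos ht.le
  have hle : η (t + 1) ≤ 2 / (3 * (1 + m (t + 2))) := by
    rw [h.rate_succ t (by omega)]
    exact (min_le_right _ _).trans (min_le_left _ _)
  rw [le_div_iff₀ (by linarith)] at hle
  nlinarith

theorem third_le (h : IsAdaptiveRate L T m r C η) (ht : t < T) :
    1 / 3 ≤ 2 / (3 * (1 + m (t + 2))) := by
  obtain ⟨h1, h2⟩ := h.pred_mem (t + 1) (by omega)
  rw [le_div_iff₀ (by linarith)]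
  linarith

theorem half_le_sqrt (h : IsAdaptiveRate L T m r C η) : 2 / 3 ≤ Real.sqrt L :=
  Real.le_sqrt_of_sq_le (by linarith [h.half_le])

theorem rate_div_succ_le (h : IsAdaptiveRate L T m r C η) (ht : t < T) :
    η t / η (t + 1) ≤ 3 * Real.sqrt L := by
  have hpos := h.rate_pos ht.le
  have hs := h.half_le_sqrt
  have hC := h.error_pos t ht
  have hL := h.half_le
  rw [div_le_iff₀ (h.rate_pos ht), h.rate_succ t ht, ← div_le_iff₀' (by positivity)]
  refine le_min ?_ (le_min (le_trans ?_ (h.third_le ht)) ?_)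
  · exact div_le_self hpos.le (by linarith)
  · rw [div_le_iff₀ (by positivity)]
    linarith [h.rate_le_sqrt ht.le]
  · apply Real.le_sqrt_of_sq_le
    rw [div_pow, mul_pow, Real.sq_sqrt (by linarith), div_le_div_iff₀ (by positivity) hC]
    nlinarith [h.rate_sq_mul_error_succ_le ht]

theorem inv_rate_le (h : IsAdaptiveRate L T m r C η) (ht : t ≤ T) :
    (η t)⁻¹ ≤ 3 + Real.sqrt (C t) / Real.sqrt L := by
  have hL := h.half_le
  have hs := h.half_le_sqrt
  induction t with
  | zero =>
    rw [h.error_zero, Real.sqrt_zero, zero_div, add_zero, inv_le_comm₀ (h.rate_pos ht) three_pos,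
      h.rate_zero]
    exact Real.le_sqrt_of_sq_le (by linarith)
  | succ t ih =>
    have hC := h.error_pos t ht
    have hq : 0 < Real.sqrt (C (t + 1)) / Real.sqrt L :=
      div_pos (Real.sqrt_pos.2 hC) (by linarith)
    rw [inv_le_comm₀ (h.rate_pos ht) (by positivity), h.rate_succ t ht]
    refine le_min ?_ (le_min (le_trans ?_ (h.third_le ht)) ?_)
    · rw [inv_le_comm₀ (by positivity) (h.rate_pos (by omega))]
      refine (ih (by omega)).trans ?_
      gcongr
      exact h.error_le_succ ht
    · rw [one_div]
      exact inv_anti₀ three_pos (by linarith)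
    · rw [Real.sqrt_div (by linarith), ← inv_div (Real.sqrt (C (t + 1)))]
      exact inv_anti₀ hq (by linarith)

theorem sum_rate_div_succ_sub_one_le (h : IsAdaptiveRate L T m r C η) (ht : t ≤ T) :
    ∑ s ∈ range t, (η s / η (s + 1) - 1) ≤ 3 * Real.sqrt L * Real.log (η 0 / η t) := by
  induction t with
  | zero => simp [div_self (h.rate_pos ht).ne']
  | succ t ih =>
    have h0 := h.rate_pos (Nat.zero_le T)
    have h1 := h.rate_pos (Nat.le_of_succ_le ht)
    have h2 := h.rate_pos ht
    have hratio : 1 ≤ η t / η (t + 1) := (one_le_div h2).2 (h.rate_succ_le ht)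
    have hlog := Real.one_sub_inv_le_log_of_pos (zero_lt_one.trans_le hratio)
    have hstep : η t / η (t + 1) - 1 ≤ 3 * Real.sqrt L * Real.log (η t / η (t + 1)) := by
      have hmul : η t / η (t + 1) - 1 = η t / η (t + 1) * (1 - (η t / η (t + 1))⁻¹) := by
        field_simp
      calc η t / η (t + 1) - 1 ≤ η t / η (t + 1) * Real.log (η t / η (t + 1)) := by
            rw [hmul]
            gcongr
        _ ≤ _ := mul_le_mul_of_nonneg_right (h.rate_div_succ_le ht) (Real.log_nonneg hratio)
    rw [sum_range_succ, ← div_mul_div_cancel₀ (a := η 0) (c := η (t + 1)) h1.ne',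
      Real.log_mul (by positivity) (by positivity), mul_add]
    exact add_le_add (ih (by omega)) hstep

theorem sum_rate_mul_sq_le (h : IsAdaptiveRate L T m r C η) (ht : t ≤ T) :
    ∑ s ∈ range t, η s * (r (s + 1) - m (s + 1)) ^ 2 ≤ 4 * Real.sqrt L * Real.sqrt (C t) := by
  induction t with
  | zero => simp [h.error_zero]
  | succ t ih =>
    rw [sum_range_succ]
    have hC := h.error_pos t ht
    have hC0 := h.error_nonneg (Nat.le_of_succ_le ht)
    have hL := h.half_le
    have hη := h.rate_pos (Nat.le_of_succ_le ht)
    have hsqrt : η t * Real.sqrt (C (t + 1)) ≤ 2 * Real.sqrt L := by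
      refine le_of_sq_le_sq ?_ (by positivity)
      rw [mul_pow, mul_pow, Real.sq_sqrt hC.le, Real.sq_sqrt (by linarith)]
      linarith [h.rate_sq_mul_error_succ_le ht]
    have hmono := Real.sqrt_le_sqrt (h.error_le_succ ht)
    have hd : (r (t + 1) - m (t + 1)) ^ 2 = Real.sqrt (C (t + 1)) ^ 2 - Real.sqrt (C t) ^ 2 := by
      rw [Real.sq_sqrt hC.le, Real.sq_sqrt hC0, h.error_succ t ht]
      ring
    have hstep : η t * (r (t + 1) - m (t + 1)) ^ 2 ≤
        2 * (2 * Real.sqrt L) * (Real.sqrt (C (t + 1)) - Real.sqrt (C t)) := by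
      calc η t * (r (t + 1) - m (t + 1)) ^ 2
          = η t * (Real.sqrt (C (t + 1)) + Real.sqrt (C t)) *
              (Real.sqrt (C (t + 1)) - Real.sqrt (C t)) := by rw [hd]; ring
        _ ≤ _ := by
          refine mul_le_mul_of_nonneg_right ?_ (sub_nonneg.2 hmono)
          nlinarith
    linarith [ih (by omega)]

theorem log_rate_div_le (h : IsAdaptiveRate L T m r C η) (hT : 1 ≤ T) :
    Real.log (η 0 / η T) ≤ 6 * Real.sqrt L + Real.log (T + 3) := by
  have hL := h.half_le
  have hs := h.half_le_sqrt
  have hT' : (1 : ℝ) ≤ T := by exact_mod_cast hT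
  have h0 := h.rate_pos (Nat.zero_le T)
  have hsT : (1 : ℝ) ≤ Real.sqrt T := Real.one_le_sqrt.2 hT'
  have hC : Real.sqrt (C T) ≤ 2 * Real.sqrt T := by
    rw [Real.sqrt_le_left (by positivity), mul_pow, Real.sq_sqrt (by positivity)]
    linarith [h.error_le le_rfl]
  have hle : η 0 / η T ≤ 6 * Real.sqrt L * Real.sqrt T := by
    calc η 0 / η T = η 0 * (η T)⁻¹ := div_eq_mul_inv _ _
      _ ≤ Real.sqrt L * (3 + Real.sqrt (C T) / Real.sqrt L) :=
        mul_le_mul (h.rate_le_sqrt (Nat.zero_le T)) (h.inv_rate_le le_rfl)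
          (inv_nonneg.2 (h.rate_pos le_rfl).le) (Real.sqrt_nonneg L)
      _ = 3 * Real.sqrt L + Real.sqrt (C T) := by field_simp
      _ ≤ _ := by nlinarith
  refine (Real.log_le_log (div_pos h0 (h.rate_pos le_rfl)) hle).trans ?_
  rw [Real.log_mul (by positivity) (by positivity)]
  refine add_le_add (Real.log_le_self (by positivity)) (Real.log_le_log (by positivity) ?_)
  rw [Real.sqrt_le_left (by positivity)]
  nlinarith

theorem log_weight_eq (h : IsAdaptiveRate L T m r C η) {w : ℕ → ℝ} (w_zero : w 0 = 1)
    (w_succ : ∀ t < T, w (t + 1) = (w t * Real.exp (η t * r (t + 1) -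
      η t ^ 2 * (r (t + 1) - m (t + 1)) ^ 2)) ^ (η (t + 1) / η t))
    (w_pos : ∀ t ≤ T, 0 < w t) (ht : t ≤ T) : Real.log (w t) =
      η t * ∑ s ∈ range t, (r (s + 1) - η s * (r (s + 1) - m (s + 1)) ^ 2) := by
  induction t with
  | zero => simp [w_zero]
  | succ t ih =>
    have hw := w_pos t (by omega)
    have hη := h.rate_pos (Nat.le_of_succ_le ht)
    rw [w_succ t ht, Real.log_rpow (by positivity), Real.log_mul hw.ne' (Real.exp_pos _).ne',
      Real.log_exp, ih (by omega), sum_range_succ]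
    field_simp

end IsAdaptiveRate

theorem sum_weights_le {K T n : ℕ} {L : ℝ} {m w r C η : ℕ → Fin K → ℝ}
    (h : ∀ i, IsAdaptiveRate L T (m · i) (r · i) (C · i) (η · i))
    (w_zero : ∀ i, w 0 i = 1)
    (w_succ : ∀ t < T, ∀ i, w (t + 1) i = (w t i * Real.exp (η t i * r (t + 1) i -
      η t i ^ 2 * (r (t + 1) i - m (t + 1) i) ^ 2)) ^ (η (t + 1) i / η t i))
    (w_pos : ∀ t ≤ T, ∀ i, 0 < w t i) (m_one : ∀ i, m 1 i = 0)
    (balance : ∀ t < T, ∑ i, η t i * w t i * Real.exp (η t i * m (t + 1) i) * r (t + 1) i = 0)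
    (hn : n < T) :
    ∑ i, w (n + 1) i ≤ 2 * K + ∑ i, ∑ t ∈ range (n + 1), (η t i / η (t + 1) i - 1) := by
  have step : ∀ t < T, ∑ i, w (t + 1) i ≤ ∑ i, w t i * Real.exp (η t i * m (t + 1) i) *
      Real.exp (η t i * (r (t + 1) i - m (t + 1) i) -
        (η t i * (r (t + 1) i - m (t + 1) i)) ^ 2) +
      ∑ i, (η t i / η (t + 1) i - 1) := by
    intro t ht
    rw [← sum_add_distrib]
    refine sum_le_sum fun i _ => ?_
    have h1 := (h i).rate_pos (t := t) ht.le
    have h2 := (h i).rate_pos (t := t + 1) ht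
    have hw := w_pos t ht.le i
    rw [w_succ t ht i]
    refine (Real.rpow_le_add_inv_sub_one (by positivity) (div_pos h2 h1)
      ((div_le_one h1).2 ((h i).rate_succ_le ht))).trans_eq ?_
    rw [inv_div, mul_assoc, ← Real.exp_add]
    ring_nf
  induction n with
  | zero =>
    refine (step 0 hn).trans ?_
    simp only [zero_add, sum_range_one]
    gcongr
    calc _ ≤ ∑ _i : Fin K, (2 : ℝ) := sum_le_sum fun i _ => by
          rw [w_zero, m_one, mul_zero, Real.exp_zero, one_mul, one_mul]
          exact Real.exp_sub_sq_le_two _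
      _ = 2 * K := by simp [mul_comm]
  | succ n ih =>
    have hdecr : ∑ i, w (n + 1) i * Real.exp (η (n + 1) i * m (n + 2) i) *
        Real.exp (η (n + 1) i * (r (n + 2) i - m (n + 2) i) -
          (η (n + 1) i * (r (n + 2) i - m (n + 2) i)) ^ 2) ≤ ∑ i, w (n + 1) i := by
      rw [← add_zero (∑ i, w (n + 1) i), ← balance (n + 1) hn, ← sum_add_distrib]
      refine sum_le_sum fun i _ => ?_
      have hw := w_pos (n + 1) hn.le i
      have hexp := Real.exp_sub_sq_le_one_add ((h i).neg_two_thirds_le hn)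
      have hone := Real.exp_mul_one_sub_le_one (η (n + 1) i * m (n + 2) i)
      have he := Real.exp_pos (η (n + 1) i * m (n + 2) i)
      have ha := mul_le_mul_of_nonneg_left hexp (mul_pos hw he).le
      have hb := mul_le_mul_of_nonneg_left hone hw.le
      linarith
    have := step (n + 1) hn
    simp_rw [sum_range_succ _ (n + 1), sum_add_distrib (s := univ)]
    linarith [ih (by omega)]

theorem log_sum_weights_le {K T : ℕ} {m w r C η : ℕ → Fin K → ℝ} (hK : 2 ≤ K) (hT : 1 ≤ T)
    (h : ∀ i, IsAdaptiveRate (Real.log K) T (m · i) (r · i) (C · i) (η · i))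
    (w_pos : ∀ i, 0 < w T i)
    (hsum : ∑ i, w T i ≤ 2 * K + ∑ i, ∑ t ∈ range T, (η t i / η (t + 1) i - 1)) (i : Fin K) :
    Real.log (w T i) ≤ 8 * Real.log K + Real.log (Real.log (T + 3)) := by
  have hK' : (2 : ℝ) ≤ K := by exact_mod_cast hK
  have hT' : (1 : ℝ) ≤ T := by exact_mod_cast hT
  have hs : Real.sqrt (Real.log K) ≤ K := by
    rw [Real.sqrt_le_left (by positivity)]
    nlinarith [Real.log_le_self (show (0 : ℝ) ≤ K by positivity)]
  have hs0 := Real.sqrt_nonneg (Real.log K)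
  have hlogT : 1 ≤ Real.log (T + 3) := by
    rw [Real.le_log_iff_exp_le (by positivity)]
    linarith [Real.exp_one_lt_d9]
  set l := Real.log (T + 3)
  have hone : ∀ j, ∑ t ∈ range T, (η t j / η (t + 1) j - 1) ≤ 21 * K ^ 2 * l := by
    intro j
    calc _ ≤ 3 * Real.sqrt (Real.log K) * Real.log (η 0 j / η T j) :=
          (h j).sum_rate_div_succ_sub_one_le le_rfl
      _ ≤ 3 * Real.sqrt (Real.log K) * (6 * Real.sqrt (Real.log K) + l) := by
          gcongr
          exact (h j).log_rate_div_le hT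
      _ ≤ 3 * K * (6 * (K * l) + K * l) := by
          have : Real.sqrt (Real.log K) ≤ K * l := by nlinarith
          have : l ≤ K * l := by nlinarith
          gcongr
      _ = _ := by ring
  have hle : w T i ≤ 2 ^ 5 * K ^ 3 * l := by
    calc w T i ≤ ∑ j, w T j := single_le_sum (fun j _ => (w_pos j).le) (mem_univ i)
      _ ≤ 2 * K + ∑ _j : Fin K, 21 * (K : ℝ) ^ 2 * l :=
          hsum.trans (by gcongr with j; exact hone j)
      _ = 2 * K + 21 * (K ^ 3 * l) := by simp; ring
      _ ≤ _ := by
          have : (K : ℝ) ≤ K ^ 3 * l := by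
            calc (K : ℝ) = K ^ 1 * 1 := by ring
              _ ≤ K ^ 3 * l := by gcongr <;> linarith
          nlinarith
  refine (Real.log_le_log (w_pos i) hle).trans ?_
  rw [Real.log_mul (by positivity) (by positivity), Real.log_mul (by positivity) (by positivity),
    Real.log_pow, Real.log_pow]
  have := Real.log_le_log two_pos hK'
  push_cast
  linarith

theorem IsAdaptiveRate.sum_regret_le {L M : ℝ} {T : ℕ} {m r C η w : ℕ → ℝ}
    (h : IsAdaptiveRate L T m r C η) (hM : 0 ≤ M)
    (hlog : Real.log (w T) =
      η T * ∑ s ∈ range T, (r (s + 1) - η s * (r (s + 1) - m (s + 1)) ^ 2))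
    (hw : Real.log (w T) ≤ 8 * L + M) :
    ∑ t ∈ range T, r (t + 1) ≤
      24 * (L + M + (Real.sqrt L + M) * Real.sqrt (C T)) := by
  have hη := h.rate_pos le_rfl
  have hs := h.half_le_sqrt
  have hL := h.half_le
  have hq := h.sum_rate_mul_sq_le le_rfl
  rw [sum_sub_distrib] at hlog
  have hdiff : ∑ s ∈ range T, r (s + 1) - ∑ s ∈ range T, η s * (r (s + 1) - m (s + 1)) ^ 2 ≤
      (8 * L + M) * (3 + Real.sqrt (C T) / Real.sqrt L) := by
    calc _ = Real.log (w T) * (η T)⁻¹ := by rw [hlog]; field_simp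
      _ ≤ (8 * L + M) * (η T)⁻¹ := by gcongr
      _ ≤ _ := by
        gcongr
        exact h.inv_rate_le le_rfl
  have hLs : L * (Real.sqrt (C T) / Real.sqrt L) = Real.sqrt L * Real.sqrt (C T) := by
    nth_rewrite 1 [← Real.mul_self_sqrt (show 0 ≤ L by linarith)]
    field_simp
  have hMs : M * (Real.sqrt (C T) / Real.sqrt L) ≤ 2 * (M * Real.sqrt (C T)) := by
    rw [mul_div_assoc', div_le_iff₀ (by linarith)]
    nlinarith [mul_nonneg hM (Real.sqrt_nonneg (C T))]
  have h1 := mul_nonneg (Real.sqrt_nonneg L) (Real.sqrt_nonneg (C T))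
  have h2 := mul_nonneg hM (Real.sqrt_nonneg (C T))
  nlinarith

theorem balance_and_regret_mem {K : ℕ} (hK : 0 < K) {q p ℓ r : Fin K → ℝ} (hq : ∀ i, 0 < q i)
    (hp : ∀ i, p i = q i / ∑ j, q j) (hℓ : ∀ i, 0 ≤ ℓ i ∧ ℓ i ≤ 1)
    (hr : ∀ i, r i = ∑ j, p j * ℓ j - ℓ i) :
    ∑ i, q i * r i = 0 ∧ ∀ i, -1 ≤ r i ∧ r i ≤ 1 := by
  have hne : (univ : Finset (Fin K)).Nonempty := ⟨⟨0, hK⟩, mem_univ _⟩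
  have hsum : 0 < ∑ j, q j := sum_pos (fun i _ => hq i) hne
  have hmean : ∑ j, p j * ℓ j = (∑ j, q j * ℓ j) / ∑ j, q j := by
    rw [sum_div]
    exact sum_congr rfl fun j _ => by rw [hp j]; ring
  have h0 : 0 ≤ ∑ j, p j * ℓ j := by
    rw [hmean]
    exact div_nonneg (sum_nonneg fun j _ => mul_nonneg (hq j).le (hℓ j).1) hsum.le
  have h1 : ∑ j, p j * ℓ j ≤ 1 := by
    rw [hmean, div_le_one hsum]
    exact sum_le_sum fun j _ => mul_le_of_le_one_right (hq j).le (hℓ j).2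
  refine ⟨?_, fun i => ?_⟩
  · simp_rw [hr, mul_sub, sum_sub_distrib, ← sum_mul, hmean]
    rw [mul_div_cancel₀ _ hsum.ne', sub_self]
  · rw [hr]
    constructor <;> linarith [hℓ i]


theorem adaprod_static_regret_bound :
    ∃ c : ℝ, 0 < c ∧
    ∀ (K T : ℕ), 2 ≤ K → 1 ≤ T →
    ∀ (ℓ rhat : ℕ → Fin K → ℝ),
    (∀ t, 1 ≤ t → t ≤ T → ∀ i, 0 ≤ ℓ t i ∧ ℓ t i ≤ 1) →
    (∀ i, rhat 1 i = 0) →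
    (∀ i, rhat (T + 1) i = 0) →
    (∀ t, 1 ≤ t → t ≤ T + 1 → ∀ i, -1 < rhat t i ∧ rhat t i ≤ 1) →
    ∀ (w p r C η : ℕ → Fin K → ℝ),
    (∀ i, w 0 i = 1) →
    (∀ i, η 0 i = Real.sqrt (Real.log K / 2)) →
    (∀ i, C 0 i = 0) →
    (∀ t, 1 ≤ t → t ≤ T → ∀ i,
      p t i = η (t - 1) i * w (t - 1) i * Real.exp (η (t - 1) i * rhat t i) /
        ∑ j, η (t - 1) j * w (t - 1) j * Real.exp (η (t - 1) j * rhat t j)) →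
    (∀ t, 1 ≤ t → t ≤ T → ∀ i,
      r t i = (∑ j, p t j * ℓ t j) - ℓ t i) →
    (∀ t, 1 ≤ t → t ≤ T → ∀ i,
      C t i = C (t - 1) i + (rhat t i - r t i) ^ 2) →
    (∀ t, 1 ≤ t → t ≤ T → ∀ i,
      η t i = min (η (t - 1) i)
        (min (2 / (3 * (1 + rhat (t + 1) i))) (Real.sqrt (Real.log K / C t i)))) →
    (∀ t, 1 ≤ t → t ≤ T → ∀ i,
      w t i = (w (t - 1) i *
        Real.exp (η (t - 1) i * r t i - (η (t - 1) i) ^ 2 * (r t i - rhat t i) ^ 2)) ^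
          (η t i / η (t - 1) i)) →
    (∀ t, 1 ≤ t → t ≤ T → ∀ i, 0 < C t i) →
    ∀ i : Fin K, ∑ t ∈ Finset.Icc 1 T, r t i ≤
      c * (Real.log K + Real.log (Real.log (T + 3)) +
        (Real.sqrt (Real.log K) + Real.log (Real.log (T + 3))) * Real.sqrt (C T i)) := by
  refine ⟨24, by norm_num, ?_⟩
  intro K T hK hT ℓ rhat hℓ hrhat_one _ hrhat w p r C η hw0 hη0 hC0 hp hr hC hη hw hCpos i
  have hL : 1 / 2 ≤ Real.log K := by
    have := Real.log_le_log two_pos (show (2 : ℝ) ≤ K by exact_mod_cast hK)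
    linarith [Real.log_two_gt_d9]
  have η_pos : ∀ t ≤ T, ∀ j, 0 < η t j := fun t ht j =>
    adaptiveRate_pos (m := (rhat · j)) (C := (C · j)) (η := (η · j)) (by linarith) (hη0 j)
      (fun s hs => hη (s + 1) (by omega) hs j)
      (fun s hs => hCpos (s + 1) (by omega) hs j)
      (fun s hs => (hrhat (s + 1) (by omega) hs j).1) ht
  have w_succ : ∀ t < T, ∀ j, w (t + 1) j = (w t j * Real.exp (η t j * r (t + 1) j -
      η t j ^ 2 * (r (t + 1) j - rhat (t + 1) j) ^ 2)) ^ (η (t + 1) j / η t j) :=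
    fun t ht => hw (t + 1) (by omega) ht
  have w_pos : ∀ t ≤ T, ∀ j, 0 < w t j := by
    intro t
    induction t with
    | zero => simp [hw0]
    | succ t ih =>
      intro ht j
      have := ih (by omega) j
      rw [w_succ t ht j]
      positivity
  have round : ∀ t < T,
      ∑ j, η t j * w t j * Real.exp (η t j * rhat (t + 1) j) * r (t + 1) j = 0 ∧
        ∀ j, -1 ≤ r (t + 1) j ∧ r (t + 1) j ≤ 1 := fun t ht =>
    balance_and_regret_mem (by omega)
      (fun j => mul_pos (mul_pos (η_pos t ht.le j) (w_pos t ht.le j)) (Real.exp_pos _))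
      (hp (t + 1) (by omega) ht) (hℓ (t + 1) (by omega) ht) (hr (t + 1) (by omega) ht)
  have rate : ∀ j, IsAdaptiveRate (Real.log K) T (rhat · j) (r · j) (C · j) (η · j) := fun j =>
    { half_le := hL
      rate_zero := hη0 j
      error_zero := hC0 j
      error_succ := fun t ht => hC (t + 1) (by omega) ht j
      rate_succ := fun t ht => hη (t + 1) (by omega) ht j
      error_pos := fun t ht => hCpos (t + 1) (by omega) ht j
      pred_mem := fun t ht => hrhat (t + 1) (by omega) ht j
      regret_mem := fun t ht => (round t ht).2 j }
  have hsum := sum_weights_le (n := T - 1) rate hw0 w_succ w_pos hrhat_one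
    (fun t ht => (round t ht).1) (by omega)
  rw [Nat.sub_add_cancel hT] at hsum
  have hM : 0 ≤ Real.log (Real.log (T + 3)) := by
    apply Real.log_nonneg
    rw [Real.le_log_iff_exp_le (by positivity)]
    linarith [Real.exp_one_lt_d9, Nat.cast_nonneg (α := ℝ) T]
  rw [← Finset.Ico_add_one_right_eq_Icc, Finset.sum_Ico_eq_sum_range, Nat.add_sub_cancel]
  simp_rw [add_comm 1]
  exact (rate i).sum_regret_le (w := (w · i)) hM
    ((rate i).log_weight_eq (hw0 i) (fun t ht => w_succ t ht i) (fun t ht => w_pos t ht i) le_rfl)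
    (log_sum_weights_le hK hT rate (w_pos T le_rfl) hsum i)
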